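/- arXiv:math/0303219 — 7 statements merged into one kernel-verified Lean document; each statement's English description precedes it below -/
import Mathlib

section
/- Let (A,C,ψ) be a right-right entwining structure over a commutative ring R. Then the R-module Hom_R(C,A), equipped with the multiplication (f·g)(c) = Σ f(c_2)_ψ g(c_1^ψ) and the unit η_A∘ε_C, is an associative unital R-algebra #_ψ^op(C,A); moreover the operations (a·f)(c) := Σ a_ψ f(c^ψ) and (f·a)(c) := f(c)a define an (A,A)-bimodule structure on Hom_R(C,A), i.e. (ab)·f = a·(b·f), 1_A·f = f, f·(ab) = (f·a)·b, f·1_A = f, and (a·f)·b = a·(f·b) for all a,b ∈ A and f ∈ Hom_R(C,A). -/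
open TensorProduct

/-- The four axioms of a right-right entwining structure `(A, C, ψ)`:
`Σ (ab)_ψ ⊗ c^ψ = Σ a_ψ b_Ψ ⊗ c^{ψΨ}`, `Σ (1_A)_ψ ⊗ c^ψ = 1_A ⊗ c`,
`Σ a_ψ ⊗ Δ(c^ψ) = Σ a_{ψΨ} ⊗ c_1^Ψ ⊗ c_2^ψ` and `Σ ε(c^ψ) a_ψ = ε(c) a`,
expressed as equalities of linear maps. -/
structure IsEntwining (R A C : Type*) [CommRing R] [Ring A] [Algebra R A]
    [AddCommGroup C] [Module R C] [Coalgebra R C]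
    (ψ : C ⊗[R] A →ₗ[R] A ⊗[R] C) : Prop where
  mul_compat :
    ψ ∘ₗ TensorProduct.map LinearMap.id (LinearMap.mul' R A) ∘ₗ
        (TensorProduct.assoc R C A A).toLinearMap
      = TensorProduct.map (LinearMap.mul' R A) LinearMap.id ∘ₗ
        (TensorProduct.assoc R A A C).symm.toLinearMap ∘ₗ
        TensorProduct.map LinearMap.id ψ ∘ₗ
        (TensorProduct.assoc R A C A).toLinearMap ∘ₗ
        TensorProduct.map ψ LinearMap.id
  one_compat : ∀ c : C, ψ (c ⊗ₜ[R] (1 : A)) = (1 : A) ⊗ₜ[R] c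
  comul_compat :
    TensorProduct.map LinearMap.id Coalgebra.comul ∘ₗ ψ
      = (TensorProduct.assoc R A C C).toLinearMap ∘ₗ
        TensorProduct.map ψ LinearMap.id ∘ₗ
        (TensorProduct.assoc R C A C).symm.toLinearMap ∘ₗ
        TensorProduct.map LinearMap.id ψ ∘ₗ
        (TensorProduct.assoc R C C A).toLinearMap ∘ₗ
        TensorProduct.map Coalgebra.comul LinearMap.id
  counit_compat :
    (TensorProduct.rid R A).toLinearMap ∘ₗ
        TensorProduct.map LinearMap.id Coalgebra.counit ∘ₗ ψ
      = (TensorProduct.lid R A).toLinearMap ∘ₗ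
        TensorProduct.map Coalgebra.counit LinearMap.id

variable (R : Type*) {A C : Type*} [CommRing R] [Ring A] [Algebra R A]
  [AddCommGroup C] [Module R C] [Coalgebra R C]

/-- The multiplication `(f·g)(c) = Σ f(c_2)_ψ g(c_1^ψ)` on `Hom_R(C,A)`. -/
noncomputable def smashMul (ψ : C ⊗[R] A →ₗ[R] A ⊗[R] C) (f g : C →ₗ[R] A) :
    C →ₗ[R] A :=
  LinearMap.mul' R A ∘ₗ TensorProduct.map LinearMap.id g ∘ₗ ψ ∘ₗ
    TensorProduct.map LinearMap.id f ∘ₗ Coalgebra.comul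

/-- The unit `η_A ∘ ε_C` of `Hom_R(C,A)`. -/
noncomputable def smashOne : C →ₗ[R] A :=
  Algebra.linearMap R A ∘ₗ Coalgebra.counit

/-- The left `A`-operation `(a·f)(c) = Σ a_ψ f(c^ψ)` on `Hom_R(C,A)`. -/
noncomputable def smashLAct (ψ : C ⊗[R] A →ₗ[R] A ⊗[R] C) (a : A) (f : C →ₗ[R] A) :
    C →ₗ[R] A :=
  LinearMap.mul' R A ∘ₗ TensorProduct.map LinearMap.id f ∘ₗ ψ ∘ₗ
    (TensorProduct.mk R C A).flip a

/-- The right `A`-operation `(f·a)(c) = f(c)a` on `Hom_R(C,A)`. -/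
noncomputable def smashRAct (a : A) (f : C →ₗ[R] A) : C →ₗ[R] A :=
  LinearMap.mulRight R a ∘ₗ f

/-- The map `c ⊗ a ↦ Σ a_ψ g(c^ψ)`, in terms of which both the smash product and the left
action are expressed. -/
noncomputable def smashEval (ψ : C ⊗[R] A →ₗ[R] A ⊗[R] C) (g : C →ₗ[R] A) : C ⊗[R] A →ₗ[R] A :=
  LinearMap.mul' R A ∘ₗ TensorProduct.map LinearMap.id g ∘ₗ ψ

theorem smashMul_apply (ψ : C ⊗[R] A →ₗ[R] A ⊗[R] C) (f g : C →ₗ[R] A) (c : C) :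
    smashMul R ψ f g c =
      smashEval R ψ g (TensorProduct.map LinearMap.id f (Coalgebra.comul c)) := rfl

omit [Coalgebra R C] in
theorem smashLAct_apply (ψ : C ⊗[R] A →ₗ[R] A ⊗[R] C) (a : A) (f : C →ₗ[R] A) (c : C) :
    smashLAct R ψ a f c = smashEval R ψ f (c ⊗ₜ[R] a) := rfl

omit [Coalgebra R C] in
theorem mul'_map_mulRight (g : C →ₗ[R] A) (b : A) (x : A ⊗[R] C) :
    LinearMap.mul' R A (TensorProduct.map LinearMap.id (LinearMap.mulRight R b ∘ₗ g) x) =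
      LinearMap.mul' R A (TensorProduct.map LinearMap.id g x) * b := by
  induction x with
  | zero => simp
  | tmul a c => simp [mul_assoc]
  | add x y hx hy => simp only [map_add, hx, hy, add_mul]

section

variable {R}

/-- `Σ (ab)_ψ h(c^ψ) = Σ a_ψ (b_Ψ h(c^{ψΨ}))`. -/
theorem IsEntwining.smashEval_tmul_mul {ψ : C ⊗[R] A →ₗ[R] A ⊗[R] C}
    (hψ : IsEntwining R A C ψ) (h : C →ₗ[R] A) (c : C) (a b : A) :
    smashEval R ψ h (c ⊗ₜ[R] (a * b)) =
      LinearMap.mul' R A (TensorProduct.map LinearMap.id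
        (smashEval R ψ h ∘ₗ (TensorProduct.mk R C A).flip b) (ψ (c ⊗ₜ[R] a))) := by
  have key := LinearMap.congr_fun hψ.mul_compat ((c ⊗ₜ[R] a) ⊗ₜ[R] b)
  simp only [LinearMap.comp_apply, LinearEquiv.coe_coe, TensorProduct.assoc_tmul,
    TensorProduct.map_tmul, LinearMap.id_apply, LinearMap.mul'_apply] at key
  simp only [smashEval, LinearMap.comp_apply, key]
  induction ψ (c ⊗ₜ[R] a) with
  | zero => simp
  | tmul a' c' =>
    simp only [TensorProduct.assoc_tmul, TensorProduct.map_tmul, LinearMap.id_apply,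
      LinearMap.mul'_apply, LinearMap.comp_apply, LinearMap.flip_apply, TensorProduct.mk_apply]
    induction ψ (c' ⊗ₜ[R] b) with
    | zero => simp
    | tmul a'' c'' => simp [mul_assoc]
    | add x y hx hy => simp only [TensorProduct.tmul_add, map_add, mul_add, hx, hy]
  | add x y hx hy => simp only [TensorProduct.add_tmul, map_add, hx, hy]

theorem IsEntwining.smashEval_map_mul' {ψ : C ⊗[R] A →ₗ[R] A ⊗[R] C}
    (hψ : IsEntwining R A C ψ) (g h : C →ₗ[R] A) (y : C ⊗[R] (A ⊗[R] C)) :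
    smashEval R ψ h (TensorProduct.map LinearMap.id
        (LinearMap.mul' R A ∘ₗ TensorProduct.map LinearMap.id g) y) =
      LinearMap.mul' R A (TensorProduct.map LinearMap.id
        (smashEval R ψ h ∘ₗ TensorProduct.map LinearMap.id g)
        (TensorProduct.assoc R A C C (TensorProduct.map ψ LinearMap.id
          ((TensorProduct.assoc R C A C).symm y)))) := by
  induction y with
  | zero => simp
  | add x y hx hy => simp only [map_add, hx, hy]
  | tmul c z =>
    induction z with
    | zero => simp
    | add x y hx hy => simp only [TensorProduct.tmul_add, map_add, hx, hy]
    | tmul a d =>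
      simp only [TensorProduct.map_tmul, LinearMap.comp_apply, LinearMap.id_apply,
        LinearMap.mul'_apply, TensorProduct.assoc_symm_tmul, hψ.smashEval_tmul_mul]
      induction ψ (c ⊗ₜ[R] a) with
      | zero => simp
      | tmul a' c' => simp
      | add x y hx hy => simp only [TensorProduct.add_tmul, map_add, hx, hy]

/-- `Σ a_ψ (g·h)(c^ψ) = Σ (a_ψ g(c_2^ψ))_Ψ h(c_1^Ψ)`. -/
theorem IsEntwining.smashEval_smashMul {ψ : C ⊗[R] A →ₗ[R] A ⊗[R] C}
    (hψ : IsEntwining R A C ψ) (g h : C →ₗ[R] A) (x : C ⊗[R] A) :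
    smashEval R ψ (smashMul R ψ g h) x =
      smashEval R ψ h (TensorProduct.map LinearMap.id (smashEval R ψ g)
        (TensorProduct.assoc R C C A (TensorProduct.map Coalgebra.comul LinearMap.id x))) := by
  have key := LinearMap.congr_fun hψ.comul_compat x
  simp only [LinearMap.comp_apply, LinearEquiv.coe_coe] at key
  have hg : ∀ z : C ⊗[R] (C ⊗[R] A), TensorProduct.map LinearMap.id (smashEval R ψ g) z =
      TensorProduct.map LinearMap.id (LinearMap.mul' R A ∘ₗ TensorProduct.map LinearMap.id g)
        (TensorProduct.map LinearMap.id ψ z) := fun z => by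
    rw [← LinearMap.comp_apply, ← TensorProduct.map_comp]; rfl
  rw [hg, hψ.smashEval_map_mul', ← key, ← LinearMap.comp_apply (TensorProduct.map _ _),
    ← TensorProduct.map_comp]
  rfl

theorem IsEntwining.smashMul_assoc {ψ : C ⊗[R] A →ₗ[R] A ⊗[R] C}
    (hψ : IsEntwining R A C ψ) (f g h : C →ₗ[R] A) :
    smashMul R ψ (smashMul R ψ f g) h = smashMul R ψ f (smashMul R ψ g h) := by
  ext c
  have hl : ∀ z : C ⊗[R] C, TensorProduct.map LinearMap.id (smashMul R ψ f g) z =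
      TensorProduct.map LinearMap.id (smashEval R ψ g)
        (TensorProduct.map LinearMap.id (TensorProduct.map LinearMap.id f)
          (Coalgebra.comul.lTensor C z)) := fun z => by
    induction z with
    | zero => simp
    | add x y hx hy => simp only [map_add, hx, hy]
    | tmul a b => rfl
  have hr : ∀ z : C ⊗[R] C, TensorProduct.assoc R C C A
        (TensorProduct.map Coalgebra.comul LinearMap.id (TensorProduct.map LinearMap.id f z)) =
      TensorProduct.map LinearMap.id (TensorProduct.map LinearMap.id f)
        (TensorProduct.assoc R C C C (Coalgebra.comul.rTensor C z)) := fun z => by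
    induction z with
    | zero => simp
    | add x y hx hy => simp only [map_add, hx, hy]
    | tmul a b =>
      simp only [TensorProduct.map_tmul, LinearMap.id_apply, LinearMap.rTensor_tmul]
      induction Coalgebra.comul (R := R) a with
      | zero => simp
      | add x y hx hy => simp only [TensorProduct.add_tmul, map_add, hx, hy]
      | tmul a b => simp
  rw [smashMul_apply, smashMul_apply R ψ f, hl, hψ.smashEval_smashMul, hr, Coalgebra.coassoc_apply]

theorem IsEntwining.smashOne_smashMul {ψ : C ⊗[R] A →ₗ[R] A ⊗[R] C}
    (hψ : IsEntwining R A C ψ) (f : C →ₗ[R] A) : smashMul R ψ (smashOne R) f = f := by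
  ext c
  have h : ∀ z : C ⊗[R] C, smashEval R ψ f (TensorProduct.map LinearMap.id (smashOne R) z) =
      f (TensorProduct.rid R C (Coalgebra.counit.lTensor C z)) := fun z => by
    induction z with
    | zero => simp
    | add x y hx hy => simp only [map_add, hx, hy]
    | tmul a b =>
      simp [smashOne, smashEval, Algebra.algebraMap_eq_smul_one, hψ.one_compat]
  rw [smashMul_apply, h, Coalgebra.lTensor_counit_comul]
  simp

theorem IsEntwining.smashMul_smashOne {ψ : C ⊗[R] A →ₗ[R] A ⊗[R] C}
    (hψ : IsEntwining R A C ψ) (f : C →ₗ[R] A) : smashMul R ψ f (smashOne R) = f := by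
  ext c
  have h₁ : ∀ y : A ⊗[R] C,
      LinearMap.mul' R A (TensorProduct.map LinearMap.id (smashOne R) y) =
        TensorProduct.rid R A (TensorProduct.map LinearMap.id Coalgebra.counit y) := fun y => by
    induction y with
    | zero => simp
    | add x y hx hy => simp only [map_add, hx, hy]
    | tmul a b => simp [smashOne, Algebra.algebraMap_eq_smul_one]
  have h₂ : ∀ z : C ⊗[R] C, smashEval R ψ (smashOne R) (TensorProduct.map LinearMap.id f z) =
      f (TensorProduct.lid R C (Coalgebra.counit.rTensor C z)) := fun z => by
    have key := LinearMap.congr_fun hψ.counit_compat (TensorProduct.map LinearMap.id f z)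
    simp only [LinearMap.comp_apply, LinearEquiv.coe_coe] at key
    simp only [smashEval, LinearMap.comp_apply]
    rw [h₁, key]
    clear key
    induction z with
    | zero => simp
    | add x y hx hy => simp only [map_add, hx, hy]
    | tmul a b => simp
  rw [smashMul_apply, h₂, Coalgebra.rTensor_counit_comul]
  simp

theorem IsEntwining.mul_smashLAct {ψ : C ⊗[R] A →ₗ[R] A ⊗[R] C}
    (hψ : IsEntwining R A C ψ) (a b : A) (f : C →ₗ[R] A) :
    smashLAct R ψ (a * b) f = smashLAct R ψ a (smashLAct R ψ b f) :=
  LinearMap.ext fun c => hψ.smashEval_tmul_mul f c a b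

theorem IsEntwining.one_smashLAct {ψ : C ⊗[R] A →ₗ[R] A ⊗[R] C}
    (hψ : IsEntwining R A C ψ) (f : C →ₗ[R] A) : smashLAct R ψ 1 f = f := by
  ext c
  simp [smashLAct_apply, smashEval, hψ.one_compat]

end

/-- For a right-right entwining structure `(A,C,ψ)`, `Hom_R(C,A)`
with `(f·g)(c) = Σ f(c_2)_ψ g(c_1^ψ)` and unit `η_A ∘ ε_C` is an associative unital
`R`-algebra `#_ψ^op(C,A)`, and `(a·f)(c) = Σ a_ψ f(c^ψ)`, `(f·a)(c) = f(c)a` make it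
an `(A,A)`-bimodule. -/
theorem smash_product_algebra_and_bimodule
    (ψ : C ⊗[R] A →ₗ[R] A ⊗[R] C) (hψ : IsEntwining R A C ψ) :
    (∀ f g h : C →ₗ[R] A,
        smashMul R ψ (smashMul R ψ f g) h = smashMul R ψ f (smashMul R ψ g h)) ∧
    (∀ f : C →ₗ[R] A, smashMul R ψ (smashOne R) f = f) ∧
    (∀ f : C →ₗ[R] A, smashMul R ψ f (smashOne R) = f) ∧
    (∀ (a b : A) (f : C →ₗ[R] A),
        smashLAct R ψ (a * b) f = smashLAct R ψ a (smashLAct R ψ b f)) ∧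
    (∀ f : C →ₗ[R] A, smashLAct R ψ 1 f = f) ∧
    (∀ (a b : A) (f : C →ₗ[R] A),
        smashRAct R b (smashRAct R a f) = smashRAct R (a * b) f) ∧
    (∀ f : C →ₗ[R] A, smashRAct R 1 f = f) ∧
    (∀ (a b : A) (f : C →ₗ[R] A),
        smashRAct R b (smashLAct R ψ a f) = smashLAct R ψ a (smashRAct R b f)) := by
  refine ⟨hψ.smashMul_assoc, hψ.smashOne_smashMul, hψ.smashMul_smashOne, hψ.mul_smashLAct,
    hψ.one_smashLAct, fun a b f => ?_, fun f => ?_, fun a b f => ?_⟩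
  · ext c
    simp [smashRAct, mul_assoc]
  · ext c
    simp [smashRAct]
  · ext c
    exact (mul'_map_mulRight R f b _).symm
end

section
/- Let (A,C,ψ) be a right-right entwining structure over a commutative ring R, and equip A⊗_R C with the left A-action a·(ã⊗c) := aã⊗c and the right A-operation (ã⊗c)·a := Σ ã a_ψ ⊗ c^ψ. Let Hom_{A-}(A⊗_R C, A) denote the left A-linear maps, with operations (a·F)(x) := F(x·a) and (F·a)(x) := F(x)a, multiplication (F ⋆_l G)(a⊗c) := Σ G((a⊗c_1)·F(1_A⊗c_2)) and unit ε(a⊗c) := a ε_C(c). Then the map ν : Hom_R(C,A) → Hom_{A-}(A⊗_R C, A), ν(f)(a⊗c) := a f(c), is bijective with inverse h ↦ [c ↦ h(1_A⊗c)], satisfies ν(f·g) = ν(f) ⋆_l ν(g) for the multiplication (f·g)(c) = Σ f(c_2)_ψ g(c_1^ψ) on Hom_R(C,A), sends η_A∘ε_C to the unit ε, and satisfies ν(a·f) = a·ν(f) and ν(f·a) = ν(f)·a, where (a·f)(c) := Σ a_ψ f(c^ψ) and (f·a)(c) := f(c)a. -/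
open TensorProduct

variable (R : Type*) {A C : Type*} [CommRing R] [Ring A] [Algebra R A]
  [AddCommGroup C] [Module R C] [Coalgebra R C]

/-- The right `A`-operation on `A ⊗_R C`, as a linear map:
`(ã ⊗ c) · a = Σ ã a_ψ ⊗ c^ψ`. -/
noncomputable def rActMap (ψ : C ⊗[R] A →ₗ[R] A ⊗[R] C) :
    (A ⊗[R] C) ⊗[R] A →ₗ[R] A ⊗[R] C :=
  TensorProduct.map (LinearMap.mul' R A) LinearMap.id ∘ₗ
    (TensorProduct.assoc R A A C).symm.toLinearMap ∘ₗ
    TensorProduct.map LinearMap.id ψ ∘ₗ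
    (TensorProduct.assoc R A C A).toLinearMap

/-- The left `A`-operation on `A ⊗_R C`: `a · (ã ⊗ c) = aã ⊗ c`. -/
noncomputable def lActMap (a : A) : A ⊗[R] C →ₗ[R] A ⊗[R] C :=
  TensorProduct.map (LinearMap.mulLeft R a) LinearMap.id

/-- `ν : Hom_R(C,A) → Hom(A⊗C, A)`, `ν(f)(a ⊗ c) = a f(c)`. -/
noncomputable def nuMap (f : C →ₗ[R] A) : A ⊗[R] C →ₗ[R] A :=
  LinearMap.mul' R A ∘ₗ TensorProduct.map LinearMap.id f

/-- The inverse of `ν`: `h ↦ [c ↦ h(1_A ⊗ c)]`. -/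
noncomputable def nuInv (h : A ⊗[R] C →ₗ[R] A) : C →ₗ[R] A :=
  h ∘ₗ TensorProduct.mk R A C 1

/-- The multiplication `(F ⋆_l G)(a ⊗ c) = Σ G((a ⊗ c_1)·F(1_A ⊗ c_2))`. -/
noncomputable def coringStarL (ψ : C ⊗[R] A →ₗ[R] A ⊗[R] C)
    (F G : A ⊗[R] C →ₗ[R] A) : A ⊗[R] C →ₗ[R] A :=
  G ∘ₗ rActMap R ψ ∘ₗ
    TensorProduct.map LinearMap.id (F ∘ₗ TensorProduct.mk R A C 1) ∘ₗ
    (TensorProduct.assoc R A C C).symm.toLinearMap ∘ₗ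
    TensorProduct.map LinearMap.id Coalgebra.comul

/-- The counit `ε(a ⊗ c) = a ε_C(c)` of the coring `A ⊗_R C`. -/
noncomputable def coringCounit : A ⊗[R] C →ₗ[R] A :=
  (TensorProduct.rid R A).toLinearMap ∘ₗ TensorProduct.map LinearMap.id Coalgebra.counit

/-- The left `A`-operation `(a·F)(x) = F(x·a)` on `Hom_{A-}(A⊗C, A)`. -/
noncomputable def lActHom (ψ : C ⊗[R] A →ₗ[R] A ⊗[R] C) (a : A)
    (F : A ⊗[R] C →ₗ[R] A) : A ⊗[R] C →ₗ[R] A :=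
  F ∘ₗ rActMap R ψ ∘ₗ (TensorProduct.mk R (A ⊗[R] C) A).flip a

/-- The right `A`-operation `(F·a)(x) = F(x)a` on `Hom_{A-}(A⊗C, A)`. -/
noncomputable def rActHom (a : A) (F : A ⊗[R] C →ₗ[R] A) : A ⊗[R] C →ₗ[R] A :=
  LinearMap.mulRight R a ∘ₗ F

@[simp]
theorem nuMap_tmul (f : C →ₗ[R] A) (a : A) (c : C) :
    nuMap R f (a ⊗ₜ[R] c) = a * f c := by
  simp [nuMap]

@[simp]
theorem lActMap_tmul (a b : A) (c : C) :
    lActMap R a (b ⊗ₜ[R] c) = (a * b) ⊗ₜ[R] c := by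
  simp [lActMap]

theorem nuMap_lActMap (f : C →ₗ[R] A) (a : A) (x : A ⊗[R] C) :
    nuMap R f (lActMap R a x) = a * nuMap R f x := by
  induction x with
  | zero => simp
  | tmul b c => simp [mul_assoc]
  | add x y hx hy => simp [hx, hy, mul_add]

theorem rActMap_tmul (ψ : C ⊗[R] A →ₗ[R] A ⊗[R] C) (a b : A) (c : C) :
    rActMap R ψ ((b ⊗ₜ[R] c) ⊗ₜ[R] a) = lActMap R b (ψ (c ⊗ₜ[R] a)) := by
  simp only [rActMap, LinearMap.comp_apply, LinearEquiv.coe_coe, TensorProduct.assoc_tmul,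
    TensorProduct.map_tmul, LinearMap.id_apply]
  induction ψ (c ⊗ₜ[R] a) with
  | zero => simp
  | tmul d e => simp
  | add x y hx hy => simp only [TensorProduct.tmul_add, map_add, hx, hy]

theorem nuMap_smashMul (ψ : C ⊗[R] A →ₗ[R] A ⊗[R] C) (f g : C →ₗ[R] A) :
    nuMap R (smashMul R ψ f g) = coringStarL R ψ (nuMap R f) (nuMap R g) := by
  ext a c
  change nuMap R (smashMul R ψ f g) (a ⊗ₜ[R] c) =
    coringStarL R ψ (nuMap R f) (nuMap R g) (a ⊗ₜ[R] c)
  rw [nuMap_tmul]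
  change a * nuMap R g (ψ (TensorProduct.map LinearMap.id f (Coalgebra.comul c))) = _
  simp only [coringStarL, LinearMap.comp_apply, LinearEquiv.coe_coe,
    TensorProduct.map_tmul, LinearMap.id_apply]
  induction (Coalgebra.comul (R := R) c) with
  | zero => simp
  | tmul d e => simp [rActMap_tmul, nuMap_lActMap]
  | add x y hx hy => simp only [TensorProduct.tmul_add, map_add, mul_add, hx, hy]

/-- `ν : Hom_R(C,A) → Hom_{A-}(A ⊗_R C, A)`, `ν(f)(a⊗c) = a f(c)`,
is an isomorphism of `A`-rings `#_ψ^op(C,A) ≅ ^*(A ⊗_R C)` with inverse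
`h ↦ [c ↦ h(1_A ⊗ c)]`. -/
theorem nu_iso_of_smash_with_coring_dual
    (ψ : C ⊗[R] A →ₗ[R] A ⊗[R] C) (hψ : IsEntwining R A C ψ) :
    -- ν lands in the left `A`-linear maps
    (∀ (f : C →ₗ[R] A) (a : A) (x : A ⊗[R] C),
        nuMap R f (lActMap R a x) = a * nuMap R f x) ∧
    -- `h ↦ h(1 ⊗ -)` is a left inverse of ν
    (∀ f : C →ₗ[R] A, nuInv R (nuMap R f) = f) ∧
    -- and a right inverse on the left `A`-linear maps
    (∀ F : A ⊗[R] C →ₗ[R] A,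
        (∀ (a : A) (x : A ⊗[R] C), F (lActMap R a x) = a * F x) →
        nuMap R (nuInv R F) = F) ∧
    -- ν is multiplicative for `·` and `⋆_l`
    (∀ f g : C →ₗ[R] A, nuMap R (smashMul R ψ f g) = coringStarL R ψ (nuMap R f) (nuMap R g)) ∧
    -- ν sends `η_A ∘ ε_C` to the counit of the coring
    (nuMap R (smashOne R) = coringCounit R (A := A) (C := C)) ∧
    -- ν is compatible with the `A`-bimodule operations
    (∀ (a : A) (f : C →ₗ[R] A),
        nuMap R (smashLAct R ψ a f) = lActHom R ψ a (nuMap R f)) ∧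
    (∀ (a : A) (f : C →ₗ[R] A),
        nuMap R (smashRAct R a f) = rActHom R a (nuMap R f)) := by
  refine ⟨nuMap_lActMap R, fun f => ?_, fun F hF => ?_, nuMap_smashMul R ψ, ?_,
    fun a f => ?_, fun a f => ?_⟩
  · ext c
    simp [nuInv]
  · ext a c
    simp [nuInv, ← hF]
  · ext a c
    simp [smashOne, coringCounit, Algebra.smul_def, Algebra.commutes]
  · ext b c
    simp [lActHom, rActMap_tmul, nuMap_lActMap]
    rfl
  · ext b c
    simp [smashRAct, rActHom, mul_assoc]
end

section
/- Let R be a noetherian commutative ring and (A,C,ψ) a right-right entwining structure over R. Let Ã ⊆ C^* be a unital R-subalgebra of the convolution algebra C^* = Hom_R(C,R), and let C̃ be an R-coalgebra together with an injective R-linear map ι : C̃ → Hom_R(A,R) such that ι(f)(ab) = Σ ι(f_1)(a) ι(f_2)(b) and ι(f)(1_A) = ε_{C̃}(f) for all f ∈ C̃ and a,b ∈ A. Assume the canonical R-linear maps Ã⊗_R C̃ → (C⊗_R A)^*, g⊗f ↦ [c⊗a ↦ g(c)·ι(f)(a)], and Ã⊗_R C̃⊗_R C̃ → (C⊗_R A⊗_R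 A)^*, g⊗f⊗f' ↦ [c⊗a⊗b ↦ g(c)ι(f)(a)ι(f')(b)], are injective. Let φ : C̃⊗_R Ã → Ã⊗_R C̃ be an R-linear map, written φ(f⊗g) = Σ g_φ ⊗ f^φ, such that Σ g_φ(c)·ι(f^φ)(a) = Σ ι(f)(a_ψ)·g(c^ψ) for all f ∈ C̃, g ∈ Ã, c ∈ C, a ∈ A. Then (Ã,C̃,φ) is a right-right entwining structure, i.e. for all f ∈ C̃ and g,h ∈ Ã: Σ (g⋆h)_φ ⊗ f^φ = Σ (g_φ ⋆ h_Φ) ⊗ f^{φΦ}; Σ (ε_C)_φ ⊗ f^φ = ε_C ⊗ f; Σ g_φ ⊗ Δ_{C̃}(f^φ) = Σ g_{φΦ} ⊗ (f_1)^Φ ⊗ (f_2)^φ; and Σ ε_{C̃}(f^φ) g_φ = ε_{C̃}(f) g, where ⋆ denotes the convolution product on C^* and ε_C is its unit. -/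
open TensorProduct

/-- The convolution product on the dual `C^* = Hom_R(C,R)` of a coalgebra:
`(f ⋆ g)(c) = Σ f(c_1) g(c_2)`. -/
noncomputable def convProd (R C : Type*) [CommRing R] [AddCommGroup C] [Module R C]
    [Coalgebra R C] (f g : Module.Dual R C) : Module.Dual R C :=
  LinearMap.mul' R R ∘ₗ TensorProduct.map f g ∘ₗ Coalgebra.comul

section Pairings

variable {R A C A' C' : Type*} [CommRing R] [Ring A] [Algebra R A] [AddCommGroup C] [Module R C]
  [Ring A'] [Algebra R A'] [AddCommGroup C'] [Module R C']

/-- Pairing `c ⊗ a` with a tensor whose first leg is multiplied by `g` splits along a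
representation of the comultiplication of `c`. -/
lemma dualDistrib_map_mulLeft [Coalgebra R C] (κ : A' →ₗ[R] Module.Dual R C)
    (hκmul : ∀ g h : A', κ (g * h) = convProd R C (κ g) (κ h)) (ι : C' →ₗ[R] Module.Dual R A)
    (g : A') (s : A' ⊗[R] C') {c : C} {X : Type*} (r : Coalgebra.Repr R c X) (a : A) :
    dualDistrib R C A (map κ ι (map (LinearMap.mulLeft R g) LinearMap.id s)) (c ⊗ₜ a)
      = ∑ i ∈ r.index, κ g (r.left i) *
          dualDistrib R C A (map κ ι s) (r.right i ⊗ₜ a) := by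
  induction s with
  | zero => simp
  | add x y hx hy => simp only [map_add, LinearMap.add_apply, hx, hy, mul_add,
      Finset.sum_add_distrib]
  | tmul h f =>
    simp [hκmul, convProd, ← r.eq, Finset.sum_mul, mul_assoc]

lemma map_mul'_assoc_symm_map_assoc_tmul (φ : C' ⊗[R] A' →ₗ[R] A' ⊗[R] C') (g h : A') (f : C') :
    map (LinearMap.mul' R A') LinearMap.id ((TensorProduct.assoc R A' A' C').symm
        (map LinearMap.id φ (TensorProduct.assoc R A' C' A' ((g ⊗ₜ f) ⊗ₜ h))))
      = map (LinearMap.mulLeft R g) LinearMap.id (φ (f ⊗ₜ h)) := by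
  simp only [assoc_tmul, map_tmul, LinearMap.id_apply]
  induction φ (f ⊗ₜ h) with
  | zero => simp
  | add x y hx hy => simp only [map_add, tmul_add, hx, hy]
  | tmul h f => simp

lemma dualDistrib_convProd [Coalgebra R C] (α : Module.Dual R A) (g h : Module.Dual R C)
    (x : A ⊗[R] C) :
    dualDistrib R A C (α ⊗ₜ convProd R C g h) x
      = dualDistrib R A (C ⊗[R] C) (α ⊗ₜ dualDistrib R C C (g ⊗ₜ h))
          (map LinearMap.id Coalgebra.comul x) := by
  induction x with
  | zero => simp
  | add x y hx hy => simp only [map_add, hx, hy]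
  | tmul a c =>
    simp only [dualDistrib_apply, map_tmul, LinearMap.id_apply, convProd, LinearMap.comp_apply]
    congr 1

lemma dualDistrib_assoc_tmul (α : Module.Dual R A) (g h : Module.Dual R C) (y : A ⊗[R] C) (c : C) :
    dualDistrib R A (C ⊗[R] C) (α ⊗ₜ dualDistrib R C C (g ⊗ₜ h))
        (TensorProduct.assoc R A C C (y ⊗ₜ c))
      = dualDistrib R A C (α ⊗ₜ g) y * h c := by
  induction y with
  | zero => simp
  | add x y hx hy => simp only [map_add, add_tmul, hx, hy, add_mul]
  | tmul a d => simp [mul_assoc]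

lemma dualDistrib_assoc_map_assoc_symm (ψ : C ⊗[R] A →ₗ[R] A ⊗[R] C) (α : Module.Dual R A)
    (g h : Module.Dual R C) (c : C) (x : A ⊗[R] C) :
    dualDistrib R A (C ⊗[R] C) (α ⊗ₜ dualDistrib R C C (g ⊗ₜ h))
        (TensorProduct.assoc R A C C (map ψ LinearMap.id
          ((TensorProduct.assoc R C A C).symm (c ⊗ₜ x))))
      = dualDistrib R A C ((dualDistrib R A C (α ⊗ₜ g) ∘ₗ ψ ∘ₗ mk R C A c) ⊗ₜ h) x := by
  induction x with
  | zero => simp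
  | add x y hx hy => simp only [map_add, tmul_add, hx, hy]
  | tmul a d => simp [dualDistrib_assoc_tmul]

lemma dualDistrib_map_comul [Coalgebra R C'] (κ : A' →ₗ[R] Module.Dual R C)
    (ι : C' →ₗ[R] Module.Dual R A)
    (hιmul : ∀ (f : C') (a b : A), ι f (a * b) =
      dualDistrib R A A (map ι ι (Coalgebra.comul f)) (a ⊗ₜ b))
    (t : A' ⊗[R] C') (c : C) (a b : A) :
    dualDistrib R C (A ⊗[R] A) (map κ (dualDistrib R A A ∘ₗ map ι ι)
        (map LinearMap.id Coalgebra.comul t)) (c ⊗ₜ (a ⊗ₜ b))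
      = dualDistrib R C A (map κ ι t) (c ⊗ₜ (a * b)) := by
  induction t with
  | zero => simp
  | add x y hx hy => simp only [map_add, LinearMap.add_apply, hx, hy]
  | tmul g f => simp [hιmul]

lemma dualDistrib_map_assoc_tmul (κ : A' →ₗ[R] Module.Dual R C) (ι : C' →ₗ[R] Module.Dual R A)
    (u : A' ⊗[R] C') (f : C') (c : C) (a b : A) :
    dualDistrib R C (A ⊗[R] A) (map κ (dualDistrib R A A ∘ₗ map ι ι)
        (TensorProduct.assoc R A' C' C' (u ⊗ₜ f))) (c ⊗ₜ (a ⊗ₜ b))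
      = dualDistrib R C A (map κ ι u) (c ⊗ₜ a) * ι f b := by
  induction u with
  | zero => simp
  | add x y hx hy => simp only [map_add, LinearMap.add_apply, add_tmul, hx, hy, add_mul]
  | tmul g f => simp [mul_assoc]

lemma dualDistrib_tmul_comp_flip_mk (κ : A' →ₗ[R] Module.Dual R C) (ι : C' →ₗ[R] Module.Dual R A)
    (g : A') (f f' : C') (b : A) (y : A ⊗[R] C) :
    dualDistrib R A C (ι f ⊗ₜ (dualDistrib R C A (κ g ⊗ₜ ι f') ∘ₗ (mk R C A).flip b)) y
      = dualDistrib R A C (ι f ⊗ₜ κ g) y * ι f' b := by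
  induction y with
  | zero => simp
  | add x y hx hy => simp only [map_add, hx, hy, add_mul]
  | tmul a c => simp [mul_assoc]

/-- The multiplicativity of `ι`, contracted against `g` in the last leg. -/
lemma dualDistrib_map_mul'_assoc_symm [Coalgebra R C'] (ι : C' →ₗ[R] Module.Dual R A)
    (hιmul : ∀ (f : C') (a b : A), ι f (a * b) =
      dualDistrib R A A (map ι ι (Coalgebra.comul f)) (a ⊗ₜ b))
    (g : Module.Dual R C) {f : C'} {X : Type*}
    (r : Coalgebra.Repr R f X) (a : A) (z : A ⊗[R] C) :
    dualDistrib R A C (ι f ⊗ₜ g) (map (LinearMap.mul' R A) LinearMap.id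
        ((TensorProduct.assoc R A A C).symm (a ⊗ₜ z)))
      = ∑ i ∈ r.index, ι (r.left i) a * dualDistrib R A C (ι (r.right i) ⊗ₜ g) z := by
  induction z with
  | zero => simp
  | add x y hx hy => simp only [map_add, tmul_add, hx, hy, mul_add, Finset.sum_add_distrib]
  | tmul b c => simp [hιmul, ← r.eq, Finset.sum_mul, mul_assoc]

end Pairings

/-- Given an entwining structure `(A,C,ψ)` over a noetherian ring `R`,
a unital `R`-subalgebra `A' ⊆ C^*` of the convolution algebra (realized as an `R`-algebra
`A'` with an injective, unital, multiplicative linear embedding `κ` into `C^*`), an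
`R`-coalgebra `C' ⊆ A^*` (realized via an injective linear `ι : C' → A^*` with
`ι(f)(ab) = Σ ι(f_1)(a) ι(f_2)(b)` and `ι(f)(1) = ε(f)`), such that the canonical maps
`A' ⊗ C' → (C ⊗ A)^*` and `A' ⊗ C' ⊗ C' → (C ⊗ A ⊗ A)^*` are injective, and an
`R`-linear `φ : C' ⊗ A' → A' ⊗ C'` dualizing `ψ`, the triple `(A',C',φ)` is a
right-right entwining structure. -/
theorem dual_entwining {R A C A' C' : Type*} [CommRing R] [IsNoetherianRing R]
    [Ring A] [Algebra R A] [AddCommGroup C] [Module R C] [Coalgebra R C]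
    [Ring A'] [Algebra R A'] [AddCommGroup C'] [Module R C'] [Coalgebra R C']
    (ψ : C ⊗[R] A →ₗ[R] A ⊗[R] C) (hψ : IsEntwining R A C ψ)
    -- `A' ⊆ C^*` is a unital `R`-subalgebra of the convolution algebra
    (κ : A' →ₗ[R] Module.Dual R C) (hκinj : Function.Injective κ)
    (hκmul : ∀ g h : A', κ (g * h) = convProd R C (κ g) (κ h))
    (hκone : κ 1 = Coalgebra.counit)
    -- `C' ⊆ A^*` is an `R`-coalgebra dually measuring `A`
    (ι : C' →ₗ[R] Module.Dual R A) (hιinj : Function.Injective ι)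
    (hιmul : ∀ (f : C') (a b : A),
        ι f (a * b) =
          TensorProduct.dualDistrib R A A
            (TensorProduct.map ι ι (Coalgebra.comul f)) (a ⊗ₜ[R] b))
    (hιone : ∀ f : C', ι f 1 = Coalgebra.counit f)
    -- injectivity of the canonical map `A' ⊗ C' → (C ⊗ A)^*`
    (hinj2 : Function.Injective
        (TensorProduct.dualDistrib R C A ∘ₗ TensorProduct.map κ ι))
    -- injectivity of the canonical map `A' ⊗ (C' ⊗ C') → (C ⊗ (A ⊗ A))^*`
    (hinj3 : Function.Injective
        (TensorProduct.dualDistrib R C (A ⊗[R] A) ∘ₗ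
          TensorProduct.map κ
            (TensorProduct.dualDistrib R A A ∘ₗ TensorProduct.map ι ι)))
    -- the dual entwining map `φ(f ⊗ g) = Σ g_φ ⊗ f^φ` with
    -- `Σ g_φ(c) ι(f^φ)(a) = Σ ι(f)(a_ψ) g(c^ψ)`
    (φ : C' ⊗[R] A' →ₗ[R] A' ⊗[R] C')
    (hφ : ∀ (f : C') (g : A') (c : C) (a : A),
        TensorProduct.dualDistrib R C A
            (TensorProduct.map κ ι (φ (f ⊗ₜ[R] g))) (c ⊗ₜ[R] a)
          = TensorProduct.dualDistrib R A C
              (TensorProduct.map ι κ (f ⊗ₜ[R] g)) (ψ (c ⊗ₜ[R] a))) :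
    IsEntwining R A' C' φ := by
  have hP : ∀ f g c a, dualDistrib R C A (map κ ι (φ (f ⊗ₜ[R] g))) (c ⊗ₜ[R] a)
      = dualDistrib R A C (ι f ⊗ₜ κ g) (ψ (c ⊗ₜ a)) := hφ
  have ext2 : ∀ s t : A' ⊗[R] C', (∀ c a, dualDistrib R C A (map κ ι s) (c ⊗ₜ a)
      = dualDistrib R C A (map κ ι t) (c ⊗ₜ a)) → s = t := fun s t h ↦
    hinj2 (TensorProduct.ext' h)
  constructor
  · refine TensorProduct.ext_threefold fun f g h ↦ ext2 _ _ fun c a ↦ ?_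
    let r := Coalgebra.Repr.arbitrary R c
    have hcomul : map LinearMap.id Coalgebra.comul (ψ (c ⊗ₜ a)) =
        ∑ i ∈ r.index, TensorProduct.assoc R A C C (map ψ LinearMap.id
          ((TensorProduct.assoc R C A C).symm (r.left i ⊗ₜ ψ (r.right i ⊗ₜ a)))) := by
      have := LinearMap.congr_fun hψ.comul_compat (c ⊗ₜ a)
      simpa [← r.eq, sum_tmul] using this
    have hright : ∀ t : A' ⊗[R] C',
        dualDistrib R C A (map κ ι (map (LinearMap.mul' R A') LinearMap.id
          ((TensorProduct.assoc R A' A' C').symm (map LinearMap.id φ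
            (TensorProduct.assoc R A' C' A' (t ⊗ₜ h)))))) (c ⊗ₜ a)
        = ∑ i ∈ r.index, dualDistrib R A C ((dualDistrib R C A (map κ ι t) ∘ₗ
            mk R C A (r.left i)) ⊗ₜ κ h) (ψ (r.right i ⊗ₜ a)) := by
      intro t
      induction t with
      | zero => simp
      | add x y hx hy => simp only [map_add, add_tmul, LinearMap.add_apply, LinearMap.add_comp,
          hx, hy, Finset.sum_add_distrib]
      | tmul g' f' =>
        rw [map_mul'_assoc_symm_map_assoc_tmul, dualDistrib_map_mulLeft κ hκmul ι g' _ r]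
        refine Finset.sum_congr rfl fun i _ ↦ ?_
        rw [hP]
        induction ψ (r.right i ⊗ₜ a) with
        | zero => simp
        | add x y hx hy => simp only [map_add, mul_add, hx, hy]
        | tmul b d => simp [mul_assoc]
    refine Eq.trans ?_ (hright (φ (f ⊗ₜ g))).symm
    have hcomp : ∀ d, dualDistrib R C A (map κ ι (φ (f ⊗ₜ g))) ∘ₗ mk R C A d
        = dualDistrib R A C (ι f ⊗ₜ κ g) ∘ₗ ψ ∘ₗ mk R C A d := fun d ↦
      LinearMap.ext fun b ↦ hP f g d b
    simp only [LinearMap.comp_apply, LinearEquiv.coe_coe, assoc_tmul, map_tmul,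
      LinearMap.id_apply, LinearMap.mul'_apply, hP, hκmul, dualDistrib_convProd, hcomul, map_sum,
      dualDistrib_assoc_map_assoc_symm, hcomp]
  · refine fun f ↦ ext2 _ _ fun c a ↦ ?_
    have hcounit := congrArg (ι f) (LinearMap.congr_fun hψ.counit_compat (c ⊗ₜ a))
    have hcontract : ∀ x : A ⊗[R] C, dualDistrib R A C (ι f ⊗ₜ Coalgebra.counit) x
        = ι f (TensorProduct.rid R A (map LinearMap.id Coalgebra.counit x)) := by
      intro x
      induction x with
      | zero => simp
      | add x y hx hy => simp only [map_add, hx, hy]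
      | tmul b d => simp [mul_comm]
    rw [hP, hκone, hcontract]
    simpa [hκone] using hcounit
  · refine TensorProduct.ext' fun f g ↦ hinj3 (TensorProduct.ext_threefold' ?_)
    intro c a b
    let r := Coalgebra.Repr.arbitrary R f
    have hmul : ψ (c ⊗ₜ (a * b)) = map (LinearMap.mul' R A) LinearMap.id
        ((TensorProduct.assoc R A A C).symm (map LinearMap.id ψ
          (TensorProduct.assoc R A C A (ψ (c ⊗ₜ a) ⊗ₜ b)))) := by
      simpa using LinearMap.congr_fun hψ.mul_compat ((c ⊗ₜ a) ⊗ₜ b)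
    have hright : ∀ (f₁ : C') (s : A' ⊗[R] C'),
        dualDistrib R C (A ⊗[R] A) (map κ (dualDistrib R A A ∘ₗ map ι ι)
          (TensorProduct.assoc R A' C' C' (map φ LinearMap.id
            ((TensorProduct.assoc R C' A' C').symm (f₁ ⊗ₜ s))))) (c ⊗ₜ (a ⊗ₜ b))
        = dualDistrib R A C (ι f₁ ⊗ₜ (dualDistrib R C A (map κ ι s) ∘ₗ (mk R C A).flip b))
            (ψ (c ⊗ₜ a)) := by
      intro f₁ s
      induction s with
      | zero => simp
      | add x y hx hy => simp only [map_add, tmul_add, LinearMap.add_apply, LinearMap.add_comp,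
          hx, hy]
      | tmul g' f' =>
        simp only [assoc_symm_tmul, map_tmul, LinearMap.id_apply, dualDistrib_map_assoc_tmul, hP,
          dualDistrib_tmul_comp_flip_mk]
    have hcomp : ∀ f₂, dualDistrib R C A (map κ ι (φ (f₂ ⊗ₜ g))) ∘ₗ (mk R C A).flip b
        = dualDistrib R A C (ι f₂ ⊗ₜ κ g) ∘ₗ ψ ∘ₗ (mk R C A).flip b := fun f₂ ↦
      LinearMap.ext fun d ↦ hP f₂ g d b
    have hleft : ∀ y : A ⊗[R] C, dualDistrib R A C (ι f ⊗ₜ κ g)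
        (map (LinearMap.mul' R A) LinearMap.id ((TensorProduct.assoc R A A C).symm
          (map LinearMap.id ψ (TensorProduct.assoc R A C A (y ⊗ₜ b)))))
        = ∑ i ∈ r.index, dualDistrib R A C (ι (r.left i) ⊗ₜ
            (dualDistrib R A C (ι (r.right i) ⊗ₜ κ g) ∘ₗ ψ ∘ₗ (mk R C A).flip b)) y := by
      intro y
      induction y with
      | zero => simp
      | add x y hx hy => simp only [map_add, add_tmul, hx, hy, Finset.sum_add_distrib]
      | tmul a' c' =>
        simp [dualDistrib_map_mul'_assoc_symm ι hιmul (κ g) r]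
    simp only [LinearMap.comp_apply, LinearEquiv.coe_coe, map_tmul, LinearMap.id_apply]
    rw [dualDistrib_map_comul κ ι hιmul, hP, hmul, hleft, ← r.eq]
    simp only [sum_tmul, map_sum, LinearMap.sum_apply, assoc_tmul, map_tmul, LinearMap.id_apply,
      hright, hcomp]
  · refine TensorProduct.ext' fun f g ↦ hκinj (LinearMap.ext fun c ↦ ?_)
    have hcontract : ∀ t : A' ⊗[R] C',
        κ (TensorProduct.rid R A' (map LinearMap.id Coalgebra.counit t)) c
        = dualDistrib R C A (map κ ι t) (c ⊗ₜ 1) := by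
      intro t
      induction t with
      | zero => simp
      | add x y hx hy => simp only [map_add, LinearMap.add_apply, hx, hy]
      | tmul h f => simp [hιone, mul_comm]
    refine (hcontract _).trans ?_
    rw [hP, hψ.one_compat]
    simp [hιone]
end

section
/- Let (A,C,ψ) be a right-right entwining structure over a commutative ring R, and let M be a right A-module which is also a right C-comodule with coaction ρ_M(m) = Σ m_{⟨0⟩}⊗m_{⟨1⟩} satisfying ρ_M(ma) = Σ m_{⟨0⟩}a_ψ ⊗ m_{⟨1⟩}^ψ for all m ∈ M, a ∈ A (an entwined module). Let Ã ⊆ Hom_R(C,R) and C̃ ⊆ Hom_R(A,R) be R-submodules such that for all f ∈ C̃ and g ∈ Ã there exist finitely many g_1,…,g_n ∈ Ã and f_1,…,f_n ∈ C̃ with Σ f(a_ψ) g(c^ψ) = Σ_j g_j(c) f_j(a) for all c ∈ C, a ∈ A. Equip M^* = Hom_R(M,R) with the left A-action (a·h)(m) := h(ma) and the right operation (h·g)(m) := Σ h(m_{⟨0⟩}) g(m_{⟨1⟩}) for g ∈ Ã. Call h ∈ M^* C̃-rational if there exist finitely many h_1,…,h_n ∈ M^* and f_1,…,f_n ∈ C̃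 with a·h = Σ_i f_i(a) h_i for all a ∈ A. Then for every C̃-rational h ∈ M^* and every g ∈ Ã, the element h·g is again C̃-rational. -/
open TensorProduct

/-- If `a·h = Σ f_i(a) h_i`, then `Σ h(ma_k) g(c_k) = Σ_i h_i(m) Σ f_i(a_k) g(c_k)` for every
tensor `Σ a_k ⊗ c_k`. -/
theorem dualDistrib_act_assoc_symm_tmul
    {R A C M ι : Type*} [CommRing R] [Ring A] [Algebra R A]
    [AddCommGroup C] [Module R C] [AddCommGroup M] [Module R M] [Fintype ι]
    (act : M →ₗ[R] A →ₗ[R] M) (h : Module.Dual R M) (g : Module.Dual R C)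
    (hs : ι → Module.Dual R M) (fs : ι → Module.Dual R A)
    (hrat : ∀ (m : M) (a : A), h (act m a) = ∑ i, fs i a * hs i m)
    (m : M) (s : A ⊗[R] C) :
    TensorProduct.dualDistrib R M C (h ⊗ₜ[R] g)
        (TensorProduct.map (TensorProduct.lift act) LinearMap.id
          ((TensorProduct.assoc R M A C).symm (m ⊗ₜ[R] s)))
      = ∑ i, hs i m * TensorProduct.dualDistrib R A C (fs i ⊗ₜ[R] g) s := by
  induction s with
  | zero => simp
  | add s t ihs iht =>
    simp only [TensorProduct.tmul_add, map_add, ihs, iht, mul_add, Finset.sum_add_distrib]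
  | tmul a c =>
    simp only [TensorProduct.assoc_symm_tmul, TensorProduct.map_tmul, TensorProduct.lift.tmul,
      LinearMap.id_coe, id_eq, TensorProduct.dualDistrib_apply, hrat, Finset.sum_mul]
    exact Finset.sum_congr rfl fun i _ => by ring

/-- Let `(A,C,ψ)` be an entwining structure, `M` an entwined module
(a right `A`-module, via the bilinear action `act`, and a counital coassociative right
`C`-comodule with coaction `ρ` satisfying `ρ(ma) = Σ m_{⟨0⟩}a_ψ ⊗ m_{⟨1⟩}^ψ`).
Let `Ad ⊆ C^*`, `Cd ⊆ A^*` be `R`-submodules such that each `Σ f(a_ψ) g(c^ψ)`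
(`f ∈ Cd`, `g ∈ Ad`) can be written as a finite sum `Σ_j g_j(c) f_j(a)` with
`g_j ∈ Ad`, `f_j ∈ Cd`.  Equip `M^*` with `(a·h)(m) = h(ma)` and
`(h·g)(m) = Σ h(m_{⟨0⟩}) g(m_{⟨1⟩})`.  If `h ∈ M^*` is `Cd`-rational
(i.e. `a·h = Σ f_i(a) h_i` for some `h_i ∈ M^*`, `f_i ∈ Cd`), then so is `h·g`
for every `g ∈ Ad`. -/
theorem rational_stable_under_dual_action
    {R A C M : Type*} [CommRing R] [Ring A] [Algebra R A]
    [AddCommGroup C] [Module R C] [Coalgebra R C]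
    [AddCommGroup M] [Module R M]
    (ψ : C ⊗[R] A →ₗ[R] A ⊗[R] C) (hψ : IsEntwining R A C ψ)
    -- right `A`-module structure on `M`
    (act : M →ₗ[R] A →ₗ[R] M)
    (hact_mul : ∀ (m : M) (a b : A), act (act m a) b = act m (a * b))
    (hact_one : ∀ m : M, act m 1 = m)
    -- right `C`-comodule structure on `M`
    (ρ : M →ₗ[R] M ⊗[R] C)
    (hcoassoc : TensorProduct.map LinearMap.id Coalgebra.comul ∘ₗ ρ
      = (TensorProduct.assoc R M C C).toLinearMap ∘ₗ TensorProduct.map ρ LinearMap.id ∘ₗ ρ)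
    (hcounit : ∀ m : M,
      (TensorProduct.rid R M) (TensorProduct.map LinearMap.id Coalgebra.counit (ρ m)) = m)
    -- the entwined-module compatibility `ρ(ma) = Σ m_{⟨0⟩}a_ψ ⊗ m_{⟨1⟩}^ψ`
    (hent : ∀ (m : M) (a : A),
      ρ (act m a)
        = TensorProduct.map (TensorProduct.lift act) LinearMap.id
            ((TensorProduct.assoc R M A C).symm
              (TensorProduct.map LinearMap.id (ψ ∘ₗ (TensorProduct.mk R C A).flip a) (ρ m))))
    -- the submodules `Ad ⊆ C^*` and `Cd ⊆ A^*`
    (Ad : Submodule R (Module.Dual R C)) (Cd : Submodule R (Module.Dual R A))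
    (hdual : ∀ f ∈ Cd, ∀ g ∈ Ad, ∃ (n : ℕ) (gs : Fin n → Module.Dual R C)
        (fs : Fin n → Module.Dual R A), (∀ j, gs j ∈ Ad) ∧ (∀ j, fs j ∈ Cd) ∧
        ∀ (c : C) (a : A),
          TensorProduct.dualDistrib R A C (f ⊗ₜ[R] g) (ψ (c ⊗ₜ[R] a))
            = ∑ j, gs j c * fs j a) :
    ∀ h : Module.Dual R M,
      (∃ (n : ℕ) (hs : Fin n → Module.Dual R M) (fs : Fin n → Module.Dual R A),
          (∀ i, fs i ∈ Cd) ∧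
          ∀ a : A, h ∘ₗ TensorProduct.lift act ∘ₗ (TensorProduct.mk R M A).flip a
            = ∑ i, fs i a • hs i) →
      ∀ g ∈ Ad,
        ∃ (n : ℕ) (hs : Fin n → Module.Dual R M) (fs : Fin n → Module.Dual R A),
          (∀ i, fs i ∈ Cd) ∧
          ∀ a : A,
            (TensorProduct.dualDistrib R M C (h ⊗ₜ[R] g) ∘ₗ ρ) ∘ₗ
                TensorProduct.lift act ∘ₗ (TensorProduct.mk R M A).flip a
              = ∑ i, fs i a • hs i := by
  rintro h ⟨n, hs, fs, hfs, hrat⟩ g hg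
  have hrat_apply (m : M) (a : A) : h (act m a) = ∑ i, fs i a * hs i m := by
    simpa using LinearMap.congr_fun (hrat a) m
  choose k gs fs' _ hfs' hψg using fun i => hdual (fs i) (hfs i) g hg
  let e := (Fintype.equivFin (Σ i, Fin (k i))).symm
  refine ⟨_, fun j => TensorProduct.dualDistrib R M C
    (hs (e j).1 ⊗ₜ[R] gs (e j).1 (e j).2) ∘ₗ ρ, fun j => fs' (e j).1 (e j).2,
    fun j => hfs' _ _, fun a => LinearMap.ext fun m => ?_⟩
  have key (t : M ⊗[R] C) :
      TensorProduct.dualDistrib R M C (h ⊗ₜ[R] g)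
          (TensorProduct.map (TensorProduct.lift act) LinearMap.id
            ((TensorProduct.assoc R M A C).symm
              (TensorProduct.map LinearMap.id (ψ ∘ₗ (TensorProduct.mk R C A).flip a) t)))
        = ∑ p : Σ i, Fin (k i), fs' p.1 p.2 a *
            TensorProduct.dualDistrib R M C (hs p.1 ⊗ₜ[R] gs p.1 p.2) t := by
    induction t with
    | zero => simp
    | add s t ihs iht => simp only [map_add, ihs, iht, mul_add, Finset.sum_add_distrib]
    | tmul m c =>
      simp only [TensorProduct.map_tmul, LinearMap.id_coe, id_eq, LinearMap.comp_apply,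
        LinearMap.flip_apply, TensorProduct.mk_apply,
        dualDistrib_act_assoc_symm_tmul act h g hs fs hrat_apply, hψg,
        TensorProduct.dualDistrib_apply, Fintype.sum_sigma, Finset.mul_sum]
      exact Finset.sum_congr rfl fun i _ => Finset.sum_congr rfl fun j _ => by ring
  simp only [LinearMap.comp_apply, LinearMap.flip_apply, TensorProduct.mk_apply,
    TensorProduct.lift.tmul, hent, key, LinearMap.sum_apply, LinearMap.smul_apply, smul_eq_mul]
  exact (Equiv.sum_comp e fun p => fs' p.1 p.2 a *
    TensorProduct.dualDistrib R M C (hs p.1 ⊗ₜ[R] gs p.1 p.2) (ρ m)).symm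
end

section
/- Let P = (A,C) be a measuring R-pairing satisfying the α-condition and let M be a left A-module. Then the set Rat^C(M) of C-rational elements of M is an A-submodule of M; moreover, for every left A-module L and every A-linear map f : M → L, one has f(Rat^C(M)) ⊆ Rat^C(L). -/
open TensorProduct

/-- For a pairing `κ : A → C^*` and an `R`-module `M`, the canonical map
`α_M : M ⊗_R C → Hom_R(A,M)`, `m ⊗ c ↦ [a ↦ ⟨a,c⟩ m]`. -/
noncomputable def alphaMap (R A C M : Type*) [CommRing R]
    [AddCommGroup A] [Module R A] [AddCommGroup C] [Module R C]
    [AddCommGroup M] [Module R M] (κ : A →ₗ[R] Module.Dual R C) :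
    M ⊗[R] C →ₗ[R] (A →ₗ[R] M) :=
  dualTensorHom R A M ∘ₗ (TensorProduct.comm R M (Module.Dual R A)).toLinearMap ∘ₗ
    TensorProduct.map LinearMap.id κ.flip

/-- An element `m` of a left `A`-module `M` is `C`-rational (w.r.t. a pairing
`κ : A → C^*`) if `a • m = Σ_i ⟨a, c_i⟩ m_i` for finitely many `m_i ∈ M`,
`c_i ∈ C` and all `a ∈ A`. -/
def IsRatElem {R A C : Type*} (M : Type*) [CommRing R] [Ring A] [Algebra R A]
    [AddCommGroup C] [Module R C] [Coalgebra R C]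
    [AddCommGroup M] [Module R M] [Module A M]
    (κ : A →ₗ[R] Module.Dual R C) (m : M) : Prop :=
  ∃ (n : ℕ) (ms : Fin n → M) (cs : Fin n → C),
    ∀ a : A, a • m = ∑ i, κ a (cs i) • ms i

/-- The left action of a functional on a coalgebra: `g ⇀ c = Σ g(c_2) c_1`. -/
noncomputable def dualHit (R C : Type*) [CommRing R] [AddCommGroup C] [Module R C]
    [Coalgebra R C] (g : Module.Dual R C) : C →ₗ[R] C :=
  (TensorProduct.rid R C).toLinearMap ∘ₗ LinearMap.lTensor C g ∘ₗ Coalgebra.comul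

theorem apply_dualHit {R C : Type*} [CommRing R] [AddCommGroup C] [Module R C]
    [Coalgebra R C] (f g : Module.Dual R C) (c : C) :
    f (dualHit R C g c) = convProd R C f g c := by
  simp only [dualHit, convProd, LinearMap.comp_apply]
  induction (Coalgebra.comul (R := R) c) with
  | zero => simp
  | add x y hx hy => simp only [map_add, hx, hy]
  | tmul x y => simp [mul_comm]

namespace IsRatElem

variable {R A C M L : Type*} [CommRing R] [Ring A] [Algebra R A]
  [AddCommGroup C] [Module R C] [Coalgebra R C]
  [AddCommGroup M] [Module R M] [Module A M]
  [AddCommGroup L] [Module R L] [Module A L]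
  {κ : A →ₗ[R] Module.Dual R C}

theorem zero : IsRatElem M κ 0 :=
  ⟨0, Fin.elim0, Fin.elim0, fun a => by simp⟩

theorem add {x y : M} (hx : IsRatElem M κ x) (hy : IsRatElem M κ y) :
    IsRatElem M κ (x + y) := by
  obtain ⟨n, ms, cs, h⟩ := hx
  obtain ⟨k, ms', cs', h'⟩ := hy
  exact ⟨n + k, Fin.append ms ms', Fin.append cs cs', fun a => by
    simp [smul_add, h, h', Fin.sum_univ_add]⟩

theorem smul (hκ : ∀ a b : A, κ (a * b) = convProd R C (κ a) (κ b))
    (b : A) {x : M} (hx : IsRatElem M κ x) : IsRatElem M κ (b • x) := by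
  obtain ⟨n, ms, cs, h⟩ := hx
  exact ⟨n, ms, fun i => dualHit R C (κ b) (cs i), fun a => by
    rw [← mul_smul, h]
    simp only [hκ, apply_dualHit]⟩

theorem map [IsScalarTower R A M] [IsScalarTower R A L]
    (f : M →ₗ[A] L) {x : M} (hx : IsRatElem M κ x) : IsRatElem L κ (f x) := by
  obtain ⟨n, ms, cs, h⟩ := hx
  exact ⟨n, fun i => f (ms i), cs, fun a => by
    simp only [← map_smul, h, map_sum, f.map_smul_of_tower]⟩

end IsRatElem

/-- For a measuring `α`-pairing `(A,C)` and a left `A`-module `M`,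
the set `Rat^C(M)` of `C`-rational elements is an `A`-submodule of `M`, and for any
`A`-linear `f : M → L` one has `f(Rat^C(M)) ⊆ Rat^C(L)`. -/
theorem rational_submodule_and_functorial
    {R A C M L : Type*} [CommRing R] [Ring A] [Algebra R A]
    [AddCommGroup C] [Module R C] [Coalgebra R C]
    [AddCommGroup M] [Module R M] [Module A M] [IsScalarTower R A M]
    [AddCommGroup L] [Module R L] [Module A L] [IsScalarTower R A L]
    (κ : A →ₗ[R] Module.Dual R C)
    (hκmul : ∀ a b : A, κ (a * b) = convProd R C (κ a) (κ b))
    (hκone : κ 1 = Coalgebra.counit)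
    (hα : ∀ (N : Type*) [AddCommGroup N] [Module R N],
        Function.Injective (alphaMap R A C N κ)) :
    (∃ N : Submodule A M, (N : Set M) = {m : M | IsRatElem M κ m}) ∧
    ∀ (f : M →ₗ[A] L) (m : M), IsRatElem M κ m → IsRatElem L κ (f m) := by
  exact ⟨⟨{ carrier := {m : M | IsRatElem M κ m}
            zero_mem' := IsRatElem.zero
            add_mem' := IsRatElem.add
            smul_mem' := fun b _ hx => hx.smul hκmul b }, rfl⟩,
    fun f _ hm => hm.map f⟩
end

section
/- Let R be a noetherian commutative ring, V and W R-modules, and X ⊆ V^* = Hom_R(V,R), Y ⊆ W^* = Hom_R(W,R) R-submodules. If the canonical map X⊗_R Y → R^V⊗_R Y induced by the inclusion X ⊆ R^V (the R-module of all functions V → R) is injective, then the canonical map ϖ : X⊗_R Y → (V⊗_R W)^*, f⊗g ↦ [v⊗w ↦ f(v)g(w)], is injective. -/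
open TensorProduct

/-- The canonical embedding of the linear dual `V^* = Hom_R(V,R)` into the `R`-module
`R^V` of all functions `V → R`. -/
noncomputable def dualToFun (R V : Type*) [CommRing R] [AddCommGroup V] [Module R V] :
    Module.Dual R V →ₗ[R] (V → R) :=
  LinearMap.pi fun v => LinearMap.applyₗ v

/-- Over a noetherian ring the canonical map `R^ι ⊗ N → N^ι` is injective: a tensor
`∑ i, f i ⊗ y i` vanishes as soon as all its evaluations `∑ i, f i v • y i` vanish. -/
theorem sum_pi_tmul_eq_zero {R ι N κ : Type*} [CommRing R] [IsNoetherianRing R]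
    [AddCommGroup N] [Module R N] [Fintype κ] (f : κ → ι → R) (y : κ → N)
    (h : ∀ v, ∑ i, f i v • y i = 0) : ∑ i, f i ⊗ₜ[R] y i = 0 := by
  obtain ⟨n, k, hk⟩ := Submodule.fg_iff_exists_fin_generating_family.mp
    (IsNoetherian.noetherian (LinearMap.ker (Fintype.linearCombination R y)))
  have hmem (v : ι) : ∃ c : Fin n → R, ∑ j, c j • k j = fun i => f i v := by
    rw [← Submodule.mem_span_range_iff_exists_fun, hk]
    simpa [Fintype.linearCombination_apply] using h v
  choose c hc using hmem
  have hrel (j : Fin n) : ∑ i, k j i • y i = 0 := by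
    have : k j ∈ LinearMap.ker (Fintype.linearCombination R y) :=
      hk ▸ Submodule.subset_span ⟨j, rfl⟩
    simpa [Fintype.linearCombination_apply] using this
  have hf (i : κ) : f i = ∑ j, k j i • fun v => c v j := by
    ext v
    simpa [mul_comm] using (congrFun (hc v) i).symm
  calc ∑ i, f i ⊗ₜ[R] y i = ∑ i, ∑ j, (fun v => c v j) ⊗ₜ[R] (k j i • y i) := by
        refine Finset.sum_congr rfl fun i _ => ?_
        rw [hf i, TensorProduct.sum_tmul]
        simp only [TensorProduct.smul_tmul]
    _ = 0 := by
        rw [Finset.sum_comm]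
        simp only [← TensorProduct.tmul_sum, hrel, TensorProduct.tmul_zero, Finset.sum_const_zero]

/-- The tensor product of a map `φ : X → V^*` which stays injective as a map to `R^V` after
tensoring with `Y`, and an injective map `ψ : Y → W^*`, induces an injective map
`X ⊗ Y → (V ⊗ W)^*`. -/
theorem dualDistrib_comp_map_injective {R V W X Y : Type*} [CommRing R] [IsNoetherianRing R]
    [AddCommGroup V] [Module R V] [AddCommGroup W] [Module R W]
    [AddCommGroup X] [Module R X] [AddCommGroup Y] [Module R Y]
    (φ : X →ₗ[R] Module.Dual R V) (ψ : Y →ₗ[R] Module.Dual R W) (hψ : Function.Injective ψ)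
    (hpure : Function.Injective
      (TensorProduct.map (dualToFun R V ∘ₗ φ) (LinearMap.id (M := Y)))) :
    Function.Injective (TensorProduct.dualDistrib R V W ∘ₗ TensorProduct.map φ ψ) := by
  refine (injective_iff_map_eq_zero _).mpr fun z hz => ?_
  apply hpure
  rw [map_zero]
  obtain ⟨n, x, y, rfl⟩ := TensorProduct.exists_sum_tmul_eq z
  simp only [map_sum, TensorProduct.map_tmul, LinearMap.id_apply]
  refine sum_pi_tmul_eq_zero _ y fun v => ?_
  refine hψ (LinearMap.ext fun w => ?_)
  simpa [dualToFun] using LinearMap.congr_fun hz (v ⊗ₜ[R] w)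

/-- Let `R` be noetherian, `V`, `W` `R`-modules and `X ⊆ V^*`,
`Y ⊆ W^*` `R`-submodules.  If the canonical map `X ⊗_R Y → R^V ⊗_R Y` induced by the
inclusion `X ⊆ R^V` is injective, then the canonical map
`ϖ : X ⊗_R Y → (V ⊗_R W)^*`, `f ⊗ g ↦ [v ⊗ w ↦ f(v)g(w)]`, is injective. -/
theorem dual_tensor_embedding
    {R V W : Type*} [CommRing R] [IsNoetherianRing R]
    [AddCommGroup V] [Module R V] [AddCommGroup W] [Module R W]
    (X : Submodule R (Module.Dual R V)) (Y : Submodule R (Module.Dual R W))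
    (hpure : Function.Injective
        (TensorProduct.map (dualToFun R V ∘ₗ X.subtype) (LinearMap.id (M := Y)))) :
    Function.Injective
      (TensorProduct.dualDistrib R V W ∘ₗ TensorProduct.map X.subtype Y.subtype) := by
  let _ : AddCommGroup X := inferInstanceAs (AddCommGroup (X : Submodule R (V →ₗ[R] R)))
  let _ : AddCommGroup Y := inferInstanceAs (AddCommGroup (Y : Submodule R (W →ₗ[R] R)))
  exact dualDistrib_comp_map_injective (V := V) (W := W) (X := X) (Y := Y)
    X.subtype Y.subtype Y.injective_subtype hpure
end

section
/- Let R be a noetherian commutative ring, H an R-bialgebra, and A a right H-module algebra, i.e. an R-algebra with a right H-module structure such that (ab)·h = Σ (a·h_1)(b·h_2) and 1_A·h = ε_H(h)1_A for all a,b ∈ A, h ∈ H. Then the finite dual A° = {f ∈ Hom_R(A,R) | f vanishes on some two-sided ideal I of A with A/I finitely generated over R} is a left H-submodule of A^* under the action (h⇀f)(a) := f(a·h); that is, f ∈ A° implies h⇀f ∈ A° for every h ∈ H. -/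
open TensorProduct

/-- `f ∈ A°`: a functional `f ∈ A^*` belongs to the finite dual of the `R`-algebra `A`
iff `f` vanishes on some two-sided ideal `I ⊴ A` (equivalently, an `R`-submodule closed
under left and right multiplication) such that `A/I` is a finitely generated
`R`-module. -/
def IsFiniteDualElem {R A : Type*} [CommRing R] [Ring A] [Algebra R A]
    (f : Module.Dual R A) : Prop :=
  ∃ I : Submodule R A,
    (∀ x ∈ I, ∀ a : A, a * x ∈ I ∧ x * a ∈ I) ∧
    Module.Finite R (A ⧸ I) ∧
    ∀ x ∈ I, f x = 0

/-- The largest two-sided ideal, as a submodule, on which the functional `g` vanishes. -/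
def Module.Dual.idealCore {R A : Type*} [CommRing R] [Ring A] [Algebra R A]
    (g : Module.Dual R A) : Submodule R A where
  carrier := {b | ∀ a c, g (a * b * c) = 0}
  zero_mem' := by simp
  add_mem' := by
    intro x y hx hy a c
    rw [mul_add, add_mul, map_add, hx, hy, add_zero]
  smul_mem' := by
    intro r x hx a c
    rw [mul_smul_comm, smul_mul_assoc, map_smul, hx, smul_zero]

/-- Over a noetherian ring, a functional belongs to the finite dual as soon as finitely many
linear maps `φ i : A → M` into a finite module detect its ideal core. -/
theorem isFiniteDualElem_of_forall_eq_zero {R A M ι : Type*} [CommRing R] [IsNoetherianRing R]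
    [Ring A] [Algebra R A] [AddCommGroup M] [Module R M] [Module.Finite R M] [Finite ι]
    (g : Module.Dual R A) (φ : ι → A →ₗ[R] M)
    (hg : ∀ b, (∀ i, φ i b = 0) → ∀ a c, g (a * b * c) = 0) : IsFiniteDualElem g := by
  refine ⟨g.idealCore, fun x hx a => ⟨fun b c => ?_, fun b c => ?_⟩, ?_, fun x hx => ?_⟩
  · simpa only [mul_assoc] using hx (b * a) c
  · simpa only [mul_assoc] using hx b (a * c)
  · have hle : LinearMap.ker (LinearMap.pi φ) ≤ g.idealCore := fun b hb =>
      hg b fun i => congrFun (LinearMap.mem_ker.mp hb) i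
    have : Module.Finite R (A ⧸ LinearMap.ker (LinearMap.pi φ)) :=
      Module.Finite.equiv (LinearMap.pi φ).quotKerEquivRange.symm
    exact Module.Finite.of_surjective _ (Submodule.factor_surjective hle)
  · simpa using hx 1 1

/-- Let `R` be noetherian, `H` an `R`-bialgebra and `A` a right
`H`-module algebra (with bilinear right action `act`).  Then the finite dual `A°` is a
left `H`-submodule of `A^*` under `(h ⇀ f)(a) := f(a·h)`: if `f ∈ A°` then
`h ⇀ f ∈ A°` for every `h ∈ H`. -/
theorem finite_dual_H_submodule
    {R H A : Type*} [CommRing R] [IsNoetherianRing R]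
    [Ring H] [Bialgebra R H] [Ring A] [Algebra R A]
    (act : A →ₗ[R] H →ₗ[R] A)
    (hact_mul : ∀ (a : A) (h k : H), act (act a h) k = act a (h * k))
    (hact_one : ∀ a : A, act a 1 = a)
    (hma : ∀ (a b : A) (h : H),
        act (a * b) h = LinearMap.mul' R A
          (TensorProduct.map (act a) (act b) (Coalgebra.comul h)))
    (hmone : ∀ h : H, act 1 h = Coalgebra.counit (R := R) h • (1 : A)) :
    ∀ f : Module.Dual R A, IsFiniteDualElem f →
      ∀ h : H, IsFiniteDualElem (f ∘ₗ act.flip h) := by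
  rintro f ⟨I, hI, hfin, hf⟩ h
  let r := Coalgebra.Repr.arbitrary R h
  let q := fun i => Coalgebra.Repr.arbitrary R (r.left i)
  refine isFiniteDualElem_of_forall_eq_zero _
    (fun p : (i : r.index) × (q i).index => I.mkQ ∘ₗ act.flip ((q p.1).right p.2)) ?_
  intro b hb a c
  have key : act (a * b * c) h = ∑ i ∈ r.index, ∑ j ∈ (q i).index,
      act a ((q i).left j) * act b ((q i).right j) * act c (r.right i) := by
    rw [hma, ← r.eq]
    simp only [map_sum, TensorProduct.map_tmul, LinearMap.mul'_apply]
    refine Finset.sum_congr rfl fun i _ => ?_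
    rw [hma, ← (q i).eq]
    simp only [map_sum, TensorProduct.map_tmul, LinearMap.mul'_apply, Finset.sum_mul]
  refine hf _ ?_
  rw [LinearMap.flip_apply, key]
  refine Submodule.sum_mem _ fun i hi => Submodule.sum_mem _ fun j hj => ?_
  have hbI : act b ((q i).right j) ∈ I := by
    simpa using hb ⟨⟨i, hi⟩, ⟨j, hj⟩⟩
  exact (hI _ (hI _ hbI _).1 _).2
end
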